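/- Let Q = (q_{ij}) be an l×l complex matrix with q_{ij}q_{ji} = 1, let A_Q^+ be the subalgebra of A_Q generated by {X_{i,m}, Y_{i,m} : 1 ≤ i ≤ l, m ≥ 0} and A_Q^- the subalgebra generated by {X_{i,m}, Y_{i,m} : 1 ≤ i ≤ l, m < 0}. Then the multiplication map A_Q^- ⊗ A_Q^+ → A_Q, a ⊗ b ↦ ab, is a linear isomorphism. -/

import Mathlib

/-- Generators `X i m`, `Y i m` of the algebra `A_Q`. -/
inductive AQGen (l : ℕ) : Type
  | X : Fin l → ℤ → AQGen l
  | Y : Fin l → ℤ → AQGen l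

/-- The defining relations of `A_Q`:
`X_{i,m} X_{j,n} = q_{ij} X_{j,n} X_{i,m}`, `Y_{i,m} Y_{j,n} = q_{ij} Y_{j,n} Y_{i,m}`,
`X_{i,m} Y_{j,n} − q_{ji} Y_{j,n} X_{i,m} = δ_{ij} δ_{m+n+1,0}`. -/
inductive AQRel {l : ℕ} (Q : Matrix (Fin l) (Fin l) ℂ) :
    FreeAlgebra ℂ (AQGen l) → FreeAlgebra ℂ (AQGen l) → Prop
  | XX (i j : Fin l) (m n : ℤ) :
      AQRel Q (FreeAlgebra.ι ℂ (AQGen.X i m) * FreeAlgebra.ι ℂ (AQGen.X j n))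
        (Q i j • (FreeAlgebra.ι ℂ (AQGen.X j n) * FreeAlgebra.ι ℂ (AQGen.X i m)))
  | YY (i j : Fin l) (m n : ℤ) :
      AQRel Q (FreeAlgebra.ι ℂ (AQGen.Y i m) * FreeAlgebra.ι ℂ (AQGen.Y j n))
        (Q i j • (FreeAlgebra.ι ℂ (AQGen.Y j n) * FreeAlgebra.ι ℂ (AQGen.Y i m)))
  | XY (i j : Fin l) (m n : ℤ) :
      AQRel Q (FreeAlgebra.ι ℂ (AQGen.X i m) * FreeAlgebra.ι ℂ (AQGen.Y j n)
          - Q j i • (FreeAlgebra.ι ℂ (AQGen.Y j n) * FreeAlgebra.ι ℂ (AQGen.X i m)))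
        (if i = j ∧ m + n + 1 = 0 then 1 else 0)

/-- The algebra `A_Q`, presented by the above generators and relations. -/
abbrev AQ {l : ℕ} (Q : Matrix (Fin l) (Fin l) ℂ) : Type := RingQuot (AQRel Q)

/-- The generator `X_{i,m}` of `A_Q`. -/
noncomputable def AQX {l : ℕ} (Q : Matrix (Fin l) (Fin l) ℂ) (i : Fin l) (m : ℤ) : AQ Q :=
  RingQuot.mkAlgHom ℂ (AQRel Q) (FreeAlgebra.ι ℂ (AQGen.X i m))

/-- The generator `Y_{i,m}` of `A_Q`. -/
noncomputable def AQY {l : ℕ} (Q : Matrix (Fin l) (Fin l) ℂ) (i : Fin l) (m : ℤ) : AQ Q :=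
  RingQuot.mkAlgHom ℂ (AQRel Q) (FreeAlgebra.ι ℂ (AQGen.Y i m))


open TensorProduct

/-- The subalgebra `A_Q⁺` generated by the generators with `m ≥ 0`. -/
noncomputable def AQplus {l : ℕ} (Q : Matrix (Fin l) (Fin l) ℂ) : Subalgebra ℂ (AQ Q) :=
  Algebra.adjoin ℂ ({x | ∃ (i : Fin l) (m : ℤ), 0 ≤ m ∧ (x = AQX Q i m ∨ x = AQY Q i m)})

/-- The subalgebra `A_Q⁻` generated by the generators with `m < 0`. -/
noncomputable def AQminus {l : ℕ} (Q : Matrix (Fin l) (Fin l) ℂ) : Subalgebra ℂ (AQ Q) :=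
  Algebra.adjoin ℂ ({x | ∃ (i : Fin l) (m : ℤ), m < 0 ∧ (x = AQX Q i m ∨ x = AQY Q i m)})

/-- A submodule stable under left multiplication by `s` is stable under left multiplication
by `Algebra.adjoin R s`. -/
theorem mul_mem_of_mem_adjoin {R A : Type*} [CommSemiring R] [Semiring A] [Algebra R A]
    {s : Set A} {M : Submodule R A} (h : ∀ g ∈ s, ∀ m ∈ M, g * m ∈ M) {x : A}
    (hx : x ∈ Algebra.adjoin R s) : ∀ m ∈ M, x * m ∈ M := by
  induction hx using Algebra.adjoin_induction with
  | mem x hx => exact h x hx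
  | algebraMap r =>
    intro m hm
    rw [← Algebra.smul_def]
    exact M.smul_mem r hm
  | add x y _ _ hx hy =>
    intro m hm
    rw [add_mul]
    exact M.add_mem (hx m hm) (hy m hm)
  | mul x y _ _ hx hy =>
    intro m hm
    rw [mul_assoc]
    exact hx _ (hy _ hm)

theorem RingQuot.adjoin_range_mkAlgHom_ι {R H : Type*} [CommSemiring R]
    (r : FreeAlgebra R H → FreeAlgebra R H → Prop) :
    Algebra.adjoin R (Set.range fun h => RingQuot.mkAlgHom R r (FreeAlgebra.ι R h)) = ⊤ := by
  have := AlgHom.map_adjoin (RingQuot.mkAlgHom R r) (Set.range (FreeAlgebra.ι R (X := H)))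
  rw [FreeAlgebra.adjoin_range_ι, Algebra.map_top, ← Set.range_comp,
    (AlgHom.range_eq_top _).2 (RingQuot.mkAlgHom_surjective R r)] at this
  exact this.symm

/-- The relations `ab = s(a,b) ba` of a skew polynomial algebra. -/
inductive SkewRel {H : Type*} (s : H → H → ℂ) : FreeAlgebra ℂ H → FreeAlgebra ℂ H → Prop
  | swap (a b : H) : SkewRel s (FreeAlgebra.ι ℂ a * FreeAlgebra.ι ℂ b)
      (s a b • (FreeAlgebra.ι ℂ b * FreeAlgebra.ι ℂ a))

/-- The algebra generated by `H` subject to `ab = s(a,b) ba`. -/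
def Skew {H : Type*} (s : H → H → ℂ) : Type _ := RingQuot (SkewRel s)

namespace Skew

variable {H : Type*} (s : H → H → ℂ)

noncomputable instance : Ring (Skew s) := inferInstanceAs (Ring (RingQuot (SkewRel s)))

noncomputable instance : Algebra ℂ (Skew s) :=
  inferInstanceAs (Algebra ℂ (RingQuot (SkewRel s)))

/-- The quotient map from the free algebra. -/
noncomputable def mk : FreeAlgebra ℂ H →ₐ[ℂ] Skew s := RingQuot.mkAlgHom ℂ (SkewRel s)

/-- The canonical generators. -/
noncomputable def gen (h : H) : Skew s := mk s (FreeAlgebra.ι ℂ h)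

theorem gen_mul_gen (a b : H) : gen s a * gen s b = s a b • (gen s b * gen s a) := by
  have : mk s (FreeAlgebra.ι ℂ a * FreeAlgebra.ι ℂ b) =
      mk s (s a b • (FreeAlgebra.ι ℂ b * FreeAlgebra.ι ℂ a)) :=
    RingQuot.mkAlgHom_rel ℂ (SkewRel.swap (s := s) a b)
  simpa [gen] using this

variable {s}

theorem submodule_eq_top {M : Submodule ℂ (Skew s)} (h1 : 1 ∈ M)
    (hM : ∀ h, ∀ m ∈ M, gen s h * m ∈ M) : M = ⊤ := by
  rw [eq_top_iff]
  intro x _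
  have htop : Algebra.adjoin ℂ (Set.range (gen s)) = ⊤ :=
    RingQuot.adjoin_range_mkAlgHom_ι (SkewRel s)
  have hx : x ∈ Algebra.adjoin ℂ (Set.range (gen s)) := htop ▸ Algebra.mem_top
  simpa using mul_mem_of_mem_adjoin (M := M) (by rintro _ ⟨h, rfl⟩; exact hM h) hx 1 h1

theorem linearMap_ext {V : Type*} [AddCommGroup V] [Module ℂ V] {f g : Skew s →ₗ[ℂ] V}
    (h1 : f 1 = g 1) (h : ∀ a x, f x = g x → f (gen s a * x) = g (gen s a * x)) : f = g := by
  have := submodule_eq_top (M := LinearMap.eqLocus f g) h1 h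
  exact LinearMap.ext fun x => (this ▸ Submodule.mem_top : x ∈ LinearMap.eqLocus f g)

variable {A : Type*} [Ring A] [Algebra ℂ A]

/-- The universal property. -/
noncomputable def lift (x : H → A) (hx : ∀ a b, x a * x b = s a b • (x b * x a)) :
    Skew s →ₐ[ℂ] A :=
  RingQuot.liftAlgHom ℂ ⟨FreeAlgebra.lift ℂ x, by
    rintro _ _ ⟨a, b⟩
    simpa using hx a b⟩

@[simp] theorem lift_gen (x : H → A) (hx : ∀ a b, x a * x b = s a b • (x b * x a)) (h : H) :
    lift x hx (gen s h) = x h := by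
  exact (RingQuot.liftAlgHom_mkAlgHom_apply ℂ _ _ _).trans (FreeAlgebra.lift_ι_apply x h)

/-- The matrix algebra homomorphism encoding a scaling automorphism together with a twisted
derivation. -/
noncomputable def twist (t c : H → ℂ)
    (hc : ∀ a, c a ≠ 0 → ∀ b, s a b * t b = 1 ∧ s b a = t b) :
    Skew s →ₐ[ℂ] Matrix (Fin 2) (Fin 2) (Skew s) :=
  lift (fun h => !![t h • gen s h, c h • 1; 0, gen s h]) (by
    intro a b
    have e := gen_mul_gen s a b
    have key (a b : H) : c a = (s a b * t b) * c a ∧ s b a * c a = t b * c a := by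
      by_cases h : c a = 0
      · simp [h]
      · obtain ⟨h1, h2⟩ := hc a h b
        simp [h1, h2]
    ext i j
    fin_cases i <;> fin_cases j
    · simp [e, smul_smul]
      ring_nf
    · simp only [Matrix.mul_apply, Fin.sum_univ_two, Matrix.smul_apply]
      simp [smul_smul, smul_add]
      rw [mul_comm (c b), ← (key b a).2, mul_comm (c a), ← mul_assoc, ← (key a b).1, add_comm]
    · simp
    · simp [e])

section twist

variable {t c : H → ℂ} (hc : ∀ a, c a ≠ 0 → ∀ b, s a b * t b = 1 ∧ s b a = t b)
  {t' c' : H → ℂ} (hc' : ∀ a, c' a ≠ 0 → ∀ b, s a b * t' b = 1 ∧ s b a = t' b)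

/-- The automorphism scaling each generator `h` by `t h`. -/
noncomputable def scale : Skew s →ₗ[ℂ] Skew s :=
  Matrix.entryLinearMap ℂ (Skew s) 0 0 ∘ₗ (twist t c hc).toLinearMap

/-- The twisted derivation with value `c h` on each generator `h`. -/
noncomputable def der : Skew s →ₗ[ℂ] Skew s :=
  Matrix.entryLinearMap ℂ (Skew s) 0 1 ∘ₗ (twist t c hc).toLinearMap

@[simp] theorem scale_one : scale hc 1 = 1 := by simp [scale]

@[simp] theorem der_one : der hc 1 = 0 := by simp [der]

theorem twist_lower (x : Skew s) : twist t c hc x 1 0 = 0 ∧ twist t c hc x 1 1 = x := by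
  have h0 : Matrix.entryLinearMap ℂ (Skew s) 1 0 ∘ₗ (twist t c hc).toLinearMap = 0 :=
    linearMap_ext (by simp) fun a x hx => by
      simp only [LinearMap.zero_apply, LinearMap.comp_apply, AlgHom.toLinearMap_apply,
        Matrix.entryLinearMap_apply] at hx ⊢
      simp [twist, Matrix.mul_apply, Fin.sum_univ_two] at hx ⊢
      simp [hx]
  have h1 : Matrix.entryLinearMap ℂ (Skew s) 1 1 ∘ₗ (twist t c hc).toLinearMap = .id :=
    linearMap_ext (by simp) fun a x hx => by
      simp only [LinearMap.id_apply, LinearMap.comp_apply, AlgHom.toLinearMap_apply,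
        Matrix.entryLinearMap_apply] at hx ⊢
      simp [twist, Matrix.mul_apply, Fin.sum_univ_two] at hx ⊢
      simp [hx]
  exact ⟨LinearMap.congr_fun h0 x, LinearMap.congr_fun h1 x⟩

@[simp] theorem scale_gen_mul (h : H) (x : Skew s) :
    scale hc (gen s h * x) = t h • (gen s h * scale hc x) := by
  have := (twist_lower hc x).1
  simp only [scale, LinearMap.comp_apply, AlgHom.toLinearMap_apply,
    Matrix.entryLinearMap_apply, map_mul, Matrix.mul_apply, Fin.sum_univ_two, this]
  simp [twist]

@[simp] theorem der_gen_mul (h : H) (x : Skew s) :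
    der hc (gen s h * x) = c h • x + t h • (gen s h * der hc x) := by
  have := (twist_lower hc x).2
  simp only [der, LinearMap.comp_apply, AlgHom.toLinearMap_apply,
    Matrix.entryLinearMap_apply, map_mul, Matrix.mul_apply, Fin.sum_univ_two, this]
  simp [twist, add_comm]

theorem scale_scale (x : Skew s) : scale hc (scale hc' x) = scale hc' (scale hc x) := by
  have : scale hc ∘ₗ scale hc' = scale hc' ∘ₗ scale hc :=
    linearMap_ext (by simp) fun a x hx => by
      simp only [LinearMap.comp_apply] at hx
      simp [hx, smul_smul, mul_comm]
  exact LinearMap.congr_fun this x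

theorem der_scale {k : ℂ} (hk : ∀ a, c a ≠ 0 → t' a = k) (x : Skew s) :
    der hc (scale hc' x) = k • scale hc' (der hc x) := by
  have : der hc ∘ₗ scale hc' = k • (scale hc' ∘ₗ der hc) :=
    linearMap_ext (by simp) fun a x hx => by
      have e : t' a * c a = k * c a := by
        by_cases h : c a = 0
        · simp [h]
        · rw [hk a h]
      simp only [LinearMap.comp_apply, LinearMap.smul_apply] at hx
      simp only [LinearMap.comp_apply, LinearMap.smul_apply, scale_gen_mul, map_smul, der_gen_mul,
        map_add, smul_add, hx, smul_smul, mul_smul_comm, e]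
      ring_nf
  exact LinearMap.congr_fun this x

theorem der_der {k : ℂ} (hk : ∀ a, c a ≠ 0 → t' a = k) (hk' : ∀ a, c' a ≠ 0 → k * t a = 1)
    (x : Skew s) : der hc (der hc' x) = k • der hc' (der hc x) := by
  have : der hc ∘ₗ der hc' = k • (der hc' ∘ₗ der hc) :=
    linearMap_ext (by simp) fun a x hx => by
      have e : t' a * c a = k * c a := by
        by_cases h : c a = 0
        · simp [h]
        · rw [hk a h]
      have e' : k * (t a * c' a) = c' a := by
        by_cases h : c' a = 0
        · simp [h]
        · rw [← mul_assoc, hk' a h, one_mul]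
      simp only [LinearMap.comp_apply, LinearMap.smul_apply] at hx
      simp only [LinearMap.comp_apply, LinearMap.smul_apply, map_smul, der_gen_mul,
        map_add, smul_add, hx, smul_smul, mul_smul_comm, e, e']
      rw [show t' a * (t a * k) = k * (t a * t' a) by ring]
      abel
  exact LinearMap.congr_fun this x

end twist

end Skew

/-- Commutation data `ab = s(a,b) ba + c(a,b)` on generators divided into those satisfying `P` and
those that do not, where `c` vanishes on pairs of generators in the same class. -/
structure IsSkewBracket {G : Type*} (s c : G → G → ℂ) (P : G → Prop) : Prop where
  swap (a b : G) : s a b * s b a = 1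
  antisymm (a b : G) : c b a = -(s b a * c a b)
  charge (a b : G) : c a b ≠ 0 → ∀ x, s a x * s b x = 1
  same (a b : G) : (P a ↔ P b) → c a b = 0

namespace IsSkewBracket

/-- The skew polynomial algebra on the generators outside `P`. -/
abbrev Neg {G : Type*} (s : G → G → ℂ) (P : G → Prop) : Type _ :=
  Skew fun a b : {g // ¬P g} => s a b

/-- The skew polynomial algebra on the generators in `P`. -/
abbrev Pos {G : Type*} (s : G → G → ℂ) (P : G → Prop) : Type _ :=
  Skew fun a b : {g // P g} => s a b

/-- The subalgebra generated by the images of the generators in `P`. -/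
abbrev adj {G A : Type*} [Ring A] [Algebra ℂ A] (P : G → Prop) (x : G → A) :
    Subalgebra ℂ A :=
  Algebra.adjoin ℂ (Set.image x {g | P g})

variable {G : Type*} {s c : G → G → ℂ} {P : G → Prop}

theorem eq_of_charge (hs : IsSkewBracket s c P) {a b : G} (h : c a b ≠ 0) (x : G) :
    s x b = s a x := by
  have h1 := hs.charge a b h x
  have h2 := hs.swap x b
  have h3 : s b x ≠ 0 := right_ne_zero_of_mul_eq_one h1
  exact mul_right_cancel₀ h3 (h2.trans h1.symm)

theorem twist_cond (hs : IsSkewBracket s c P) (g a : G) (h : c g a ≠ 0) (b : G) :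
    s a b * s g b = 1 ∧ s b a = s g b :=
  ⟨by rw [mul_comm]; exact hs.charge g a h b, hs.eq_of_charge h b⟩

theorem twist_cond_neg (hs : IsSkewBracket s c P) (g : G) (a : {g // ¬P g})
    (h : c g a ≠ 0) (b : {g // ¬P g}) :
    s a b * s g b = 1 ∧ s b a = s g b :=
  hs.twist_cond g a h b

variable (hs : IsSkewBracket s c P)

/-- The scaling of `Neg s P` obtained by moving `g` across. -/
noncomputable def σ (g : G) : Neg s P →ₗ[ℂ] Neg s P := Skew.scale (hs.twist_cond_neg g)

/-- The skew derivation of `Neg s P` given by bracketing with `g`. -/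
noncomputable def δ (g : G) : Neg s P →ₗ[ℂ] Neg s P := Skew.der (hs.twist_cond_neg g)

open Classical in
/-- The action of the generator `g` on `Neg s P ⊗ Pos s P`. -/
noncomputable def act (g : G) : Module.End ℂ (Neg s P ⊗[ℂ] Pos s P) :=
  if h : P g then
    TensorProduct.map (hs.σ g) (LinearMap.mulLeft ℂ (Skew.gen _ ⟨g, h⟩)) +
      TensorProduct.map (hs.δ g) LinearMap.id
  else TensorProduct.map (LinearMap.mulLeft ℂ (Skew.gen _ ⟨g, h⟩)) LinearMap.id

theorem act_pos {g : G} (h : P g) (a : Neg s P) (b : Pos s P) :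
    hs.act g (a ⊗ₜ b) = hs.σ g a ⊗ₜ (Skew.gen _ ⟨g, h⟩ * b) + hs.δ g a ⊗ₜ b := by
  simp [act, h]

theorem act_neg {g : G} (h : ¬P g) (a : Neg s P) (b : Pos s P) :
    hs.act g (a ⊗ₜ b) = (Skew.gen _ ⟨g, h⟩ * a) ⊗ₜ b := by
  simp [act, h]

theorem act_mul_act_of_pos_neg {g h : G} (hg : P g) (hh : ¬P h) :
    hs.act g * hs.act h = s g h • (hs.act h * hs.act g) + c g h • 1 := by
  refine TensorProduct.ext' fun a b => ?_
  simp [act_pos, act_neg, hg, hh, σ, δ, TensorProduct.add_tmul, TensorProduct.smul_tmul']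
  abel

theorem act_mul_act (g h : G) :
    hs.act g * hs.act h = s g h • (hs.act h * hs.act g) + c g h • 1 := by
  by_cases hg : P g <;> by_cases hh : P h
  · have e := Skew.gen_mul_gen (fun a b : {g // P g} => s a b) ⟨g, hg⟩ ⟨h, hh⟩
    have e1 (x : Neg s P) : hs.δ g (hs.σ h x) = s g h • hs.σ h (hs.δ g x) :=
      Skew.der_scale _ _ (fun a ha => hs.eq_of_charge ha h) x
    have e2 (x : Neg s P) : hs.δ h (hs.σ g x) = s h g • hs.σ g (hs.δ h x) :=
      Skew.der_scale _ _ (fun a ha => hs.eq_of_charge ha g) x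
    have e3 (x : Neg s P) : hs.δ g (hs.δ h x) = s g h • hs.δ h (hs.δ g x) :=
      Skew.der_der _ _ (fun a ha => hs.eq_of_charge ha h)
        (fun a ha => by rw [hs.eq_of_charge ha g, hs.swap]) x
    have e4 (x : Neg s P) : hs.σ g (hs.σ h x) = hs.σ h (hs.σ g x) := Skew.scale_scale _ _ x
    rw [hs.same g h (by tauto)]
    refine TensorProduct.ext' fun a b => ?_
    simp only [Module.End.mul_apply, hs.act_pos hg, hs.act_pos hh, map_add,
      LinearMap.smul_apply, zero_smul, add_zero, smul_add, e1, e2, e3, e4, ← mul_assoc, e,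
      TensorProduct.tmul_smul, ← TensorProduct.smul_tmul', smul_mul_assoc, smul_smul, hs.swap,
      one_smul]
    abel
  · exact hs.act_mul_act_of_pos_neg hg hh
  · rw [hs.act_mul_act_of_pos_neg hh hg, hs.antisymm h g, smul_add, smul_smul, smul_smul, hs.swap]
    simp [add_assoc, ← add_smul]
  · have e := Skew.gen_mul_gen (fun a b : {g // ¬P g} => s a b) ⟨g, hg⟩ ⟨h, hh⟩
    rw [hs.same g h (by tauto)]
    refine TensorProduct.ext' fun a b => ?_
    simp [hs.act_neg hg, hs.act_neg hh, ← mul_assoc, e, TensorProduct.smul_tmul']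

section realization

variable {A : Type*} [Ring A] [Algebra ℂ A] {x : G → A}

theorem range_mulMap
    (hx : ∀ a b, x a * x b = s a b • (x b * x a) + c a b • 1)
    (hgen : Algebra.adjoin ℂ (Set.range x) = ⊤) :
    Subalgebra.toSubmodule (adj (fun g => ¬P g) x) * Subalgebra.toSubmodule (adj P x) = ⊤ := by
  set N := Subalgebra.toSubmodule (adj (fun g => ¬P g) x) with hN
  set S := Subalgebra.toSubmodule (adj P x) with hS
  have hNN : N * N = N := Subalgebra.isIdempotentElem_toSubmodule _
  have hneg : ∀ h, ¬P h → ∀ m ∈ N * S, x h * m ∈ N * S := by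
    intro h hh m hm
    have : x h * m ∈ N * (N * S) :=
      Submodule.mul_mem_mul (Algebra.subset_adjoin ⟨h, hh, rfl⟩) hm
    rwa [← mul_assoc, hNN] at this
  have h1 : (1 : A) ∈ N * S := by
    simpa using Submodule.mul_mem_mul (show (1 : A) ∈ N from one_mem (adj (fun g => ¬P g) x))
      (show (1 : A) ∈ S from one_mem (adj P x))
  have hpos : ∀ g, P g → ∀ m ∈ N * S, x g * m ∈ N * S := by
    intro g hg m hm
    let M : Submodule ℂ A :=
      { carrier := {a | ∀ b ∈ S, a * b ∈ N * S ∧ x g * (a * b) ∈ N * S}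
        add_mem' := fun {a a'} h h' b hb => by
          rw [add_mul, mul_add]
          exact ⟨add_mem (h b hb).1 (h' b hb).1, add_mem (h b hb).2 (h' b hb).2⟩
        zero_mem' := fun b _ => by simp
        smul_mem' := fun r a h b hb => by
          rw [smul_mul_assoc, mul_smul_comm]
          exact ⟨Submodule.smul_mem _ r (h b hb).1, Submodule.smul_mem _ r (h b hb).2⟩ }
    have hM : ∀ y ∈ Set.image x {g | ¬P g}, ∀ a ∈ M, y * a ∈ M := by
      rintro _ ⟨h, hh, rfl⟩ a ha b hb
      obtain ⟨h2, h3⟩ := ha b hb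
      refine ⟨by rw [mul_assoc]; exact hneg h hh _ h2, ?_⟩
      rw [mul_assoc, ← mul_assoc (x g), hx g h, add_mul, smul_mul_assoc, smul_mul_assoc, one_mul,
        mul_assoc]
      exact add_mem (Submodule.smul_mem _ _ (hneg h hh _ h3)) (Submodule.smul_mem _ _ h2)
    have hM1 : (1 : A) ∈ M := fun b hb => by
      have hgb : x g * b ∈ S := (adj P x).mul_mem (Algebra.subset_adjoin ⟨g, hg, rfl⟩) hb
      have h1N : (1 : A) ∈ N := one_mem (adj (fun g => ¬P g) x)
      rw [one_mul]
      exact ⟨by simpa using Submodule.mul_mem_mul h1N hb,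
        by simpa using Submodule.mul_mem_mul h1N hgb⟩
    refine Submodule.mul_induction_on hm (fun a ha b hb => ?_) fun a b ha hb => ?_
    · have := mul_mem_of_mem_adjoin hM ha 1 hM1
      rw [mul_one] at this
      exact (this b hb).2
    · rw [mul_add]
      exact add_mem ha hb
  rw [eq_top_iff]
  intro y _
  have hy : y ∈ Algebra.adjoin ℂ (Set.range x) := hgen ▸ Algebra.mem_top
  simpa using mul_mem_of_mem_adjoin (M := N * S) (by
    rintro _ ⟨g, rfl⟩
    by_cases hg : P g
    · exact hpos g hg
    · exact hneg g hg) hy 1 h1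

/-- A skew polynomial algebra on generators in one class `R` surjects onto the subalgebra they
generate. -/
theorem exists_lift (hx : ∀ a b, x a * x b = s a b • (x b * x a) + c a b • 1)
    (R : G → Prop) (hR : ∀ a b, R a → R b → c a b = 0) :
    ∃ φ : Skew (fun a b : {g // R g} => s a b) →ₐ[ℂ] adj R x,
      (∀ g, (φ (Skew.gen _ g) : A) = x g) ∧ Function.Surjective φ := by
  let φ : Skew (fun a b : {g // R g} => s a b) →ₐ[ℂ] adj R x :=
    Skew.lift (fun g => ⟨x g, Algebra.subset_adjoin ⟨g, g.2, rfl⟩⟩) fun a b => by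
      ext
      simp [hx a b, hR a b a.2 b.2]
  have hφ : ∀ g, (φ (Skew.gen _ g) : A) = x g := fun g => by simp [φ]
  refine ⟨φ, hφ, fun y => ?_⟩
  have h : adj R x ≤ ((adj R x).val.comp φ).range :=
    Algebra.adjoin_le (by rintro _ ⟨g, hg, rfl⟩; exact ⟨Skew.gen _ ⟨g, hg⟩, hφ _⟩)
  obtain ⟨z, hz⟩ := h y.2
  exact ⟨z, Subtype.ext hz⟩

/-- If the action of the generators extends to `A`, multiplication is injective. -/
theorem mulMap_injective
    (hx : ∀ a b, x a * x b = s a b • (x b * x a) + c a b • 1)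
    (ρ : A →ₐ[ℂ] Module.End ℂ (Neg s P ⊗[ℂ] Pos s P))
    (hρ : ∀ g, ρ (x g) = hs.act g) :
    Function.Injective (Submodule.mulMap (Subalgebra.toSubmodule (adj (fun g => ¬P g) x))
      (Subalgebra.toSubmodule (adj P x))) := by
  obtain ⟨φ, hφ, hφs⟩ := exists_lift hx (fun g => ¬P g) fun a b ha hb => hs.same a b (by tauto)
  obtain ⟨ψ, hψ, hψs⟩ := exists_lift hx P fun a b ha hb => hs.same a b (by tauto)
  have hneg (b : Pos s P) (a : Neg s P) : ρ (φ a) (1 ⊗ₜ b) = a ⊗ₜ b := by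
    have : (LinearMap.applyₗ (1 ⊗ₜ b)) ∘ₗ (ρ.comp ((adj _ x).val.comp φ)).toLinearMap =
        (TensorProduct.mk ℂ (Neg s P) (Pos s P)).flip b :=
      Skew.linearMap_ext (by
        change ρ (φ 1) (1 ⊗ₜ b) = 1 ⊗ₜ b
        simp) fun g a ha => by
        replace ha : ρ (φ a) (1 ⊗ₜ b) = a ⊗ₜ b := ha
        change ρ (φ (Skew.gen _ g * a)) (1 ⊗ₜ b) = (Skew.gen _ g * a) ⊗ₜ b
        rw [map_mul, MulMemClass.coe_mul, map_mul, hφ, hρ, Module.End.mul_apply, ha,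
          hs.act_neg g.2]
    exact LinearMap.congr_fun this a
  have hpos (b : Pos s P) : ρ (ψ b) (1 ⊗ₜ 1) = 1 ⊗ₜ b := by
    have : (LinearMap.applyₗ (1 ⊗ₜ 1)) ∘ₗ (ρ.comp ((adj _ x).val.comp ψ)).toLinearMap =
        TensorProduct.mk ℂ (Neg s P) (Pos s P) 1 :=
      Skew.linearMap_ext (by
        change ρ (ψ 1) (1 ⊗ₜ 1) = 1 ⊗ₜ 1
        simp) fun g a ha => by
        replace ha : ρ (ψ a) (1 ⊗ₜ 1) = 1 ⊗ₜ a := ha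
        change ρ (ψ (Skew.gen _ g * a)) (1 ⊗ₜ 1) = 1 ⊗ₜ (Skew.gen _ g * a)
        rw [map_mul, MulMemClass.coe_mul, map_mul, hψ, hρ, Module.End.mul_apply, ha,
          hs.act_pos g.2]
        simp [σ, δ]
    exact LinearMap.congr_fun this b
  let Φ : Neg s P ⊗[ℂ] Pos s P →ₗ[ℂ]
      adj (fun g => ¬P g) x ⊗[ℂ] adj P x := TensorProduct.map φ.toLinearMap ψ.toLinearMap
  have hΦ : Function.Surjective Φ := TensorProduct.map_surjective hφs hψs
  have key : ((LinearMap.applyₗ (1 ⊗ₜ 1)) ∘ₗ ρ.toLinearMap ∘ₗ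
      Submodule.mulMap (Subalgebra.toSubmodule (adj (fun g => ¬P g) x))
        (Subalgebra.toSubmodule (adj P x))) ∘ₗ Φ = .id := by
    refine TensorProduct.ext' fun a b => ?_
    have : Submodule.mulMap (Subalgebra.toSubmodule (adj (fun g => ¬P g) x))
        (Subalgebra.toSubmodule (adj P x)) (Φ (a ⊗ₜ b)) = φ a * ψ b := rfl
    simp only [LinearMap.comp_apply, this, AlgHom.toLinearMap_apply, map_mul]
    simp [hpos, hneg]
  intro y z h
  obtain ⟨y, rfl⟩ := hΦ y
  obtain ⟨z, rfl⟩ := hΦ z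
  have hy := LinearMap.congr_fun key y
  have hz := LinearMap.congr_fun key z
  simp only [LinearMap.comp_apply, LinearMap.id_apply] at hy hz
  rw [← hy, ← hz, h]

end realization

end IsSkewBracket

namespace AQGen

variable {l : ℕ}

/-- The generators with nonnegative index. -/
def Nonneg : AQGen l → Prop
  | X _ m => 0 ≤ m
  | Y _ m => 0 ≤ m

/-- The scalar in the commutation relation of two generators. -/
def scalar (Q : Matrix (Fin l) (Fin l) ℂ) : AQGen l → AQGen l → ℂ
  | X i _, X j _ => Q i j
  | Y i _, Y j _ => Q i j
  | X i _, Y j _ => Q j i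
  | Y i _, X j _ => Q j i

/-- The constant term in the commutation relation of two generators. -/
noncomputable def const (Q : Matrix (Fin l) (Fin l) ℂ) : AQGen l → AQGen l → ℂ
  | X i m, Y j n => if i = j ∧ m + n + 1 = 0 then 1 else 0
  | Y j n, X i m => -(Q i j * if i = j ∧ m + n + 1 = 0 then 1 else 0)
  | _, _ => 0

/-- The image of a generator in `A_Q`. -/
noncomputable def toAQ (Q : Matrix (Fin l) (Fin l) ℂ) (g : AQGen l) : AQ Q :=
  RingQuot.mkAlgHom ℂ (AQRel Q) (FreeAlgebra.ι ℂ g)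

variable {Q : Matrix (Fin l) (Fin l) ℂ}

theorem isSkewBracket (hQ : ∀ i j, Q i j * Q j i = 1) :
    IsSkewBracket (scalar Q) (const Q) Nonneg where
  swap := by rintro (⟨i, m⟩ | ⟨i, m⟩) (⟨j, n⟩ | ⟨j, n⟩) <;> simp [scalar, hQ]
  antisymm := by
    rintro (⟨i, m⟩ | ⟨i, m⟩) (⟨j, n⟩ | ⟨j, n⟩) <;> simp only [scalar, const]
    · simp
    · rw [mul_neg, ← mul_assoc, hQ]; simp
    · simp
  charge := by
    rintro (⟨i, m⟩ | ⟨i, m⟩) (⟨j, n⟩ | ⟨j, n⟩) h (⟨k, p⟩ | ⟨k, p⟩) <;>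
      simp [scalar, const] at h ⊢ <;> obtain ⟨rfl, -⟩ := h.1 <;> exact hQ _ _
  same := by
    rintro (⟨i, m⟩ | ⟨i, m⟩) (⟨j, n⟩ | ⟨j, n⟩) h <;> simp only [Nonneg, const] at h ⊢
    · rw [if_neg]; omega
    · rw [if_neg] <;> [simp; omega]

theorem toAQ_mul_toAQ (hQ : ∀ i j, Q i j * Q j i = 1) (a b : AQGen l) :
    toAQ Q a * toAQ Q b = scalar Q a b • (toAQ Q b * toAQ Q a) + const Q a b • 1 := by
  have hXY (i j : Fin l) (m n : ℤ) : toAQ Q (X i m) * toAQ Q (Y j n) =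
      scalar Q (X i m) (Y j n) • (toAQ Q (Y j n) * toAQ Q (X i m)) +
        const Q (X i m) (Y j n) • 1 := by
    have := RingQuot.mkAlgHom_rel ℂ (AQRel.XY (Q := Q) i j m n)
    rw [map_sub, sub_eq_iff_eq_add'] at this
    simpa [toAQ, scalar, const, apply_ite (RingQuot.mkAlgHom ℂ (AQRel Q))] using this
  rcases a with ⟨i, m⟩ | ⟨i, m⟩ <;> rcases b with ⟨j, n⟩ | ⟨j, n⟩
  · simpa [toAQ, scalar, const] using RingQuot.mkAlgHom_rel ℂ (AQRel.XX (Q := Q) i j m n)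
  · exact hXY i j m n
  · have hs := isSkewBracket hQ
    rw [hXY, hs.antisymm (X j n) (Y i m), smul_add, smul_smul, smul_smul, hs.swap]
    simp [add_assoc, ← add_smul]
  · simpa [toAQ, scalar, const] using RingQuot.mkAlgHom_rel ℂ (AQRel.YY (Q := Q) i j m n)

/-- The universal property of `A_Q`. -/
theorem exists_algHom {B : Type*} [Ring B] [Algebra ℂ B] (y : AQGen l → B)
    (hy : ∀ a b, y a * y b = scalar Q a b • (y b * y a) + const Q a b • 1) :
    ∃ ρ : AQ Q →ₐ[ℂ] B, ∀ g, ρ (toAQ Q g) = y g := by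
  refine ⟨RingQuot.liftAlgHom ℂ ⟨FreeAlgebra.lift ℂ y, ?_⟩, fun g =>
    (RingQuot.liftAlgHom_mkAlgHom_apply ℂ _ _ _).trans (FreeAlgebra.lift_ι_apply y g)⟩
  rintro _ _ (⟨i, j, m, n⟩ | ⟨i, j, m, n⟩ | ⟨i, j, m, n⟩)
  · simpa [scalar, const] using hy (X i m) (X j n)
  · simpa [scalar, const] using hy (Y i m) (Y j n)
  · rw [map_sub, sub_eq_iff_eq_add']
    simpa [scalar, const, apply_ite (FreeAlgebra.lift ℂ y)] using hy (X i m) (Y j n)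

theorem adjoin_range_toAQ : Algebra.adjoin ℂ (Set.range (toAQ Q)) = ⊤ :=
  RingQuot.adjoin_range_mkAlgHom_ι (AQRel Q)

end AQGen

theorem AQplus_eq {l : ℕ} (Q : Matrix (Fin l) (Fin l) ℂ) :
    AQplus Q = IsSkewBracket.adj AQGen.Nonneg (AQGen.toAQ Q) := by
  refine congrArg (Algebra.adjoin ℂ) (Set.ext fun x => ⟨?_, ?_⟩)
  · rintro ⟨i, m, hm, rfl | rfl⟩
    exacts [⟨.X i m, hm, rfl⟩, ⟨.Y i m, hm, rfl⟩]
  · rintro ⟨⟨i, m⟩ | ⟨i, m⟩, hm, rfl⟩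
    exacts [⟨i, m, hm, .inl rfl⟩, ⟨i, m, hm, .inr rfl⟩]

theorem AQminus_eq {l : ℕ} (Q : Matrix (Fin l) (Fin l) ℂ) :
    AQminus Q = IsSkewBracket.adj (fun g => ¬AQGen.Nonneg g) (AQGen.toAQ Q) := by
  refine congrArg (Algebra.adjoin ℂ) (Set.ext fun x => ⟨?_, ?_⟩)
  · rintro ⟨i, m, hm, rfl | rfl⟩
    exacts [⟨.X i m, not_le.2 hm, rfl⟩, ⟨.Y i m, not_le.2 hm, rfl⟩]
  · rintro ⟨⟨i, m⟩ | ⟨i, m⟩, hm, rfl⟩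
    exacts [⟨i, m, not_le.1 hm, .inl rfl⟩, ⟨i, m, not_le.1 hm, .inr rfl⟩]

/-- triangular decomposition: the multiplication map
`A_Q⁻ ⊗ A_Q⁺ → A_Q`, `a ⊗ b ↦ ab`, is a linear isomorphism. -/
theorem stmt_17 (l : ℕ) (Q : Matrix (Fin l) (Fin l) ℂ)
    (hQ : ∀ i j, Q i j * Q j i = 1) :
    Function.Bijective
      (TensorProduct.lift
        (((LinearMap.mul ℂ (AQ Q)).comp (Subalgebra.val (AQminus Q)).toLinearMap).compl₂
          (Subalgebra.val (AQplus Q)).toLinearMap) :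
        (AQminus Q ⊗[ℂ] AQplus Q) →ₗ[ℂ] AQ Q) := by
  change Function.Bijective (Submodule.mulMap (Subalgebra.toSubmodule (AQminus Q))
    (Subalgebra.toSubmodule (AQplus Q)))
  rw [AQminus_eq, AQplus_eq]
  obtain ⟨ρ, hρ⟩ := AQGen.exists_algHom (AQGen.isSkewBracket hQ).act
    (AQGen.isSkewBracket hQ).act_mul_act
  refine ⟨(AQGen.isSkewBracket hQ).mulMap_injective (AQGen.toAQ_mul_toAQ hQ) ρ hρ, ?_⟩
  rw [← LinearMap.range_eq_top, Submodule.mulMap_range]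
  exact IsSkewBracket.range_mulMap (AQGen.toAQ_mul_toAQ hQ) AQGen.adjoin_range_toAQ
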